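/- Let X be a finite set with |X| = n and let E_0, …, E_d (d ≥ 3) be real symmetric n×n matrices satisfying: E_j·E_k = δ_{jk}·E_j, Σ_j E_j = I, E_0 = (1/n)·J, and there exist real numbers q^k_{ij} ≥ 0 (the Krein parameters) with n·(E_i ∘ E_j) = Σ_k q^k_{ij}·E_k, where ∘ denotes the entrywise product. Assume the ordering E_0, …, E_d is Q-polynomial: q^k_{1j} = 0 whenever |k − j| > 1 and q^k_{1j} > 0 whenever |k − j| = 1. Set m = q^0_{11}, a*_i = q^i_{1,i}, b*_i = q^i_{1,i+1}, c*_i = q^i_{1,i−1} (with b*_{j−1} = c*_j = a*_j = 0 for j > d) and assume m > 2. Then: (i) (a*_1)² + b*_1·c*_2 ≥ 2m(m−1)/(m+2); (ii) (a*_1)² + 2a*_1·a*_2 + c*_2·q^2_{22} ≥ 4m(m−2)/(m+4); (iii) 6m(m−1)(m−4)/((m+4)(m+6)) + ((3a*_1(a*_1+a*_2) + c*_2·q^2_{22})·b*_1·c*_2 + (a*_1)⁴)/m ≥ (7m−18)·((a*_1)² + b*_1·c*_2)/(m+6); (iv) Σ_{i=1}^{3} ( b*_i·c*_{i+1} + a*_i·Σ_{j=i}^{3}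 a*_j ) ≥ 3(3m−2)/(m+6); (v) 16m(m−1)/((m+4)(m+8)) + ((a*_1)⁴ + (3a*_1(a*_1+a*_2) + c*_2·q^2_{22})·b*_1·c*_2)/((m−2)m) ≥ 12·((a*_1)² + b*_1·c*_2)/(m+8). Moreover, if a*_1 > 0 then also: (vi) (a*_1)² + b*_1·c*_2·(2 + a*_2/a*_1) ≥ 4m(2m−3)/(m+6); (vii) (a*_1)² + 2a*_1·a*_2 − (a*_2)² + 2c*_2·q^2_{22} + (b*_2·c*_3·(a*_3 − a*_1) − m·a*_2)/(a*_1 + a*_2) ≥ 6m(m−4)/(m+6). -/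

import Mathlib

open MvPolynomial

/-- The Fischer inner product `p(∂) q` evaluated at `0`. -/
noncomputable def fischer {σ : Type*} [Fintype σ] :
    MvPolynomial σ ℝ →ₗ[ℝ] MvPolynomial σ ℝ →ₗ[ℝ] ℝ :=
  (basisMonomials σ ℝ).constr ℝ fun s => (∏ i, ((s i).factorial : ℝ)) • lcoeff ℝ s

section Fischer

variable {σ : Type*} [Fintype σ]

lemma fischer_monomial (s : σ →₀ ℕ) (a : ℝ) (q : MvPolynomial σ ℝ) :
    fischer (monomial s a) q = a * ((∏ i, ((s i).factorial : ℝ)) * q.coeff s) := by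
  have h : monomial s a = a • basisMonomials σ ℝ s := by
    simp [smul_monomial]
  rw [h, map_smul, fischer, Module.Basis.constr_basis]
  simp

lemma fischer_self_nonneg (p : MvPolynomial σ ℝ) : 0 ≤ fischer p p := by
  have h : fischer p p = ∑ s ∈ p.support, fischer (monomial s (p.coeff s)) p := by
    rw [← LinearMap.sum_apply, ← map_sum, ← p.as_sum]
  rw [h]
  refine Finset.sum_nonneg fun s _ => ?_
  rw [fischer_monomial, mul_left_comm]
  exact mul_nonneg (Finset.prod_nonneg fun i _ => by positivity) (mul_self_nonneg _)

lemma fischer_mul_X (p q : MvPolynomial σ ℝ) (i : σ) :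
    fischer (p * X i) q = fischer p (pderiv i q) := by
  classical
  induction p using MvPolynomial.induction_on' with
  | add p r hp hr => simp [add_mul, hp, hr]
  | monomial s a =>
    have hfac : (∏ j, (((s + Finsupp.single i 1 : σ →₀ ℕ) j).factorial : ℝ)) =
        (∏ j, ((s j).factorial : ℝ)) * (s i + 1) := by
      rw [← Finset.mul_prod_erase _ _ (Finset.mem_univ i),
        ← Finset.mul_prod_erase _ (fun j => ((s j).factorial : ℝ)) (Finset.mem_univ i)]
      have : ∀ j ∈ Finset.univ.erase i, (((s + Finsupp.single i 1 : σ →₀ ℕ) j).factorial : ℝ) =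
          (s j).factorial := by
        intro j hj
        simp [(Finset.ne_of_mem_erase hj).symm]
      rw [Finset.prod_congr rfl this]
      simp [Nat.factorial_succ]
      ring
    rw [X, monomial_mul, fischer_monomial, fischer_monomial, coeff_pderiv, hfac]
    ring

/-- The linear form `u ↦ ⟨y, u⟩`. -/
noncomputable def linearForm (y : σ → ℝ) : MvPolynomial σ ℝ := ∑ i, C (y i) * X i

variable (σ) in
/-- The quadratic form `u ↦ ⟨u, u⟩`. -/
noncomputable def normSqForm : MvPolynomial σ ℝ := ∑ i, X i ^ 2

/-- The Laplacian on polynomials. -/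
noncomputable def laplacian : MvPolynomial σ ℝ →ₗ[ℝ] MvPolynomial σ ℝ :=
  ∑ i, (pderiv i).toLinearMap ∘ₗ (pderiv i).toLinearMap

lemma laplacian_apply (p : MvPolynomial σ ℝ) :
    laplacian p = ∑ i, pderiv i (pderiv i p) := by
  simp [laplacian]

lemma fischer_mul_normSqForm (p q : MvPolynomial σ ℝ) :
    fischer (p * normSqForm σ) q = fischer p (laplacian q) := by
  simp only [normSqForm, laplacian_apply, Finset.mul_sum, map_sum, LinearMap.sum_apply, sq,
    ← mul_assoc, fischer_mul_X]

lemma fischer_linearForm_pow (x : σ → ℝ) (k : ℕ) (h : MvPolynomial σ ℝ)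
    (hh : h.IsHomogeneous k) :
    fischer (linearForm x ^ k) h = k.factorial * eval x h := by
  induction k generalizing h with
  | zero =>
    obtain ⟨c, rfl⟩ : ∃ c, h = C c := by
      rw [← totalDegree_zero_iff_isHomogeneous, totalDegree_eq_zero_iff_eq_C] at hh
      exact ⟨_, hh⟩
    rw [pow_zero, ← C_1, C_apply, fischer_monomial]
    simp
  | succ k ih =>
    have hd : (∑ i, x i • pderiv i h).IsHomogeneous k := by
      refine IsHomogeneous.sum _ _ _ fun i _ => ?_
      rw [smul_eq_C_mul]
      simpa using (isHomogeneous_C σ (x i)).mul hh.pderiv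
    have he : eval x (∑ i, x i • pderiv i h) = (k + 1 : ℕ) * eval x h := by
      have := congrArg (eval x) hh.sum_X_mul_pderiv
      simpa [smul_eval] using this
    have hs : fischer (linearForm x ^ (k + 1)) h =
        fischer (linearForm x ^ k) (∑ i, x i • pderiv i h) := by
      rw [pow_succ]
      conv_lhs => rw [linearForm.eq_1 x]
      simp only [linearForm.eq_1 x, Finset.mul_sum, map_sum, LinearMap.sum_apply]
      refine Finset.sum_congr rfl fun i _ => ?_
      rw [mul_left_comm, ← smul_eq_C_mul, map_smul, LinearMap.smul_apply, fischer_mul_X, map_smul]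
    rw [hs, ih _ hd, he, Nat.factorial_succ]
    push_cast
    ring

lemma pderiv_linearForm (y : σ → ℝ) (i : σ) : pderiv i (linearForm y) = C (y i) := by
  classical
  simp [linearForm, pderiv_X, Pi.single_apply]

lemma pderiv_normSqForm (i : σ) : pderiv i (normSqForm σ) = 2 * X i := by
  classical
  simp [normSqForm, pderiv_X, Pi.single_apply]

lemma laplacian_normSqForm_pow_mul (y : σ → ℝ) (hy : ∑ i, y i ^ 2 = 1) (j l : ℕ) :
    laplacian (normSqForm σ ^ j * linearForm y ^ l) =
      C (2 * j * (Fintype.card σ + 2 * (j - 1) + 2 * l) : ℝ) *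
          (normSqForm σ ^ (j - 1) * linearForm y ^ l) +
        C (l * (l - 1) : ℝ) * (normSqForm σ ^ j * linearForm y ^ (l - 2)) := by
  have hR : ∑ i : σ, (X i : MvPolynomial σ ℝ) ^ 2 = normSqForm σ := rfl
  have hL : ∑ i : σ, C (y i) * (X i : MvPolynomial σ ℝ) = linearForm y := rfl
  have hY : ∑ i : σ, (C (y i) : MvPolynomial σ ℝ) ^ 2 = 1 := by
    rw [← C_1, ← hy]; simp
  set R := normSqForm σ
  set L := linearForm y
  have hi : ∀ i, pderiv i (pderiv i (R ^ j * L ^ l)) =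
      C (2 * j : ℝ) * R ^ (j - 1) * L ^ l +
      C (4 * j * (j - 1) : ℝ) * R ^ (j - 2) * L ^ l * X i ^ 2 +
      C (4 * j * l : ℝ) * R ^ (j - 1) * L ^ (l - 1) * (C (y i) * X i) +
      C (l * (l - 1) : ℝ) * R ^ j * L ^ (l - 2) * C (y i) ^ 2 := by
    intro i
    have h1 : pderiv i R = 2 * X i := pderiv_normSqForm i
    have h2 : pderiv i L = C (y i) := pderiv_linearForm y i
    have hc : ∀ a : ℕ, ((a : MvPolynomial σ ℝ)) * ((a - 1 : ℕ) : MvPolynomial σ ℝ) =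
        a * (a - 1) := by
      intro a; cases a <;> simp
    have hn : ∀ a : ℕ, pderiv i (a : MvPolynomial σ ℝ) = 0 := fun a => by simp
    have h2' : pderiv i (2 : MvPolynomial σ ℝ) = 0 := by exact_mod_cast hn 2
    have hC4 : (C (4 : ℝ) : MvPolynomial σ ℝ) = 4 := map_ofNat _ _
    have hC2 : (C (2 : ℝ) : MvPolynomial σ ℝ) = 2 := map_ofNat _ _
    simp only [pderiv_mul, pderiv_pow, map_add, h1, h2, pderiv_C, pderiv_X_self, hn, h2',
      map_mul, map_sub, map_natCast, map_one, hC2, hC4, Nat.sub_sub, Nat.reduceAdd]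
    linear_combination (4 * R ^ (j - 2) * L ^ l * X i ^ 2) * hc j +
      (R ^ j * L ^ (l - 2) * C (y i) ^ 2) * hc l
  rw [laplacian_apply, Finset.sum_congr rfl fun i _ => hi i]
  simp only [Finset.sum_add_distrib, ← Finset.mul_sum, hR, hL, hY]
  have hC4 : (C (4 : ℝ) : MvPolynomial σ ℝ) = 4 := map_ofNat _ _
  have hC2 : (C (2 : ℝ) : MvPolynomial σ ℝ) = 2 := map_ofNat _ _
  rw [Finset.sum_const, Finset.card_univ, nsmul_eq_mul]
  simp only [map_mul, map_add, map_sub, map_natCast, map_one, hC2, hC4]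
  rcases j with _ | _ | j <;> rcases l with _ | l <;> simp <;> ring

/-- The zonal polynomial with pole `y`. -/
noncomputable def zonal (γ : ℕ → ℝ) (k : ℕ) (y : σ → ℝ) : MvPolynomial σ ℝ :=
  ∑ j ∈ Finset.range (k / 2 + 1), C (γ j) * (normSqForm σ ^ j * linearForm y ^ (k - 2 * j))

lemma laplacian_zonal (γ : ℕ → ℝ) (k : ℕ)
    (hγ : ∀ j < k / 2, γ (j + 1) * (2 * (j + 1) * (Fintype.card σ + 2 * (k - j) - 4)) =
      -((k - 2 * j) * (k - 2 * j - 1) * γ j))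
    (y : σ → ℝ) (hy : ∑ i, y i ^ 2 = 1) : laplacian (zonal γ k y) = 0 := by
  have hterm : ∀ j ∈ Finset.range (k / 2 + 1),
      laplacian (C (γ j) * (normSqForm σ ^ j * linearForm y ^ (k - 2 * j))) =
        C (γ j * (2 * j * (Fintype.card σ + 2 * (k - j) - 2))) *
          (normSqForm σ ^ (j - 1) * linearForm y ^ (k - 2 * j)) +
        C ((k - 2 * j) * (k - 2 * j - 1) * γ j) *
          (normSqForm σ ^ j * linearForm y ^ (k - 2 * j - 2)) := by
    intro j hj
    have hj' : 2 * j ≤ k := by have := Finset.mem_range.mp hj; omega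
    rw [← smul_eq_C_mul, map_smul, laplacian_normSqForm_pow_mul y hy, smul_eq_C_mul,
      Nat.cast_sub hj', mul_add]
    congr 1 <;>
    · rw [← mul_assoc, ← C_mul]
      congr 2
      push_cast
      ring
  rw [zonal, map_sum, Finset.sum_congr rfl hterm, Finset.sum_add_distrib,
    Finset.sum_range_succ', Finset.sum_range_succ _ (k / 2)]
  have htop : ((k : ℝ) - 2 * (k / 2 : ℕ)) * (k - 2 * (k / 2 : ℕ) - 1) = 0 := by
    rcases Nat.even_or_odd' k with ⟨c, rfl | rfl⟩
    · rw [Nat.mul_div_cancel_left _ two_pos]; push_cast; ring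
    · rw [show (2 * c + 1) / 2 = c by omega]; push_cast; ring
  rw [htop]
  simp only [Nat.cast_zero, mul_zero, zero_mul, C_0, add_zero]
  rw [← Finset.sum_add_distrib]
  refine Finset.sum_eq_zero fun j hj => ?_
  have h := hγ j (Finset.mem_range.mp hj)
  rw [Nat.add_sub_cancel, show k - 2 * (j + 1) = k - 2 * j - 2 by omega, ← add_mul, ← C_add]
  convert zero_mul _
  rw [← C_0]
  congr 1
  push_cast
  linear_combination h

lemma isHomogeneous_linearForm (y : σ → ℝ) : (linearForm y).IsHomogeneous 1 :=
  IsHomogeneous.sum _ _ _ fun i _ => by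
    simpa using (isHomogeneous_C σ (y i)).mul (isHomogeneous_X ℝ i)

lemma isHomogeneous_normSqForm : (normSqForm σ).IsHomogeneous 2 :=
  IsHomogeneous.sum _ _ _ fun i _ => by simpa using (isHomogeneous_X ℝ i).pow 2

lemma isHomogeneous_zonal (γ : ℕ → ℝ) (k : ℕ) (y : σ → ℝ) :
    (zonal γ k y).IsHomogeneous k := by
  refine IsHomogeneous.sum _ _ _ fun j hj => ?_
  have hj' : 2 * j ≤ k := by have := Finset.mem_range.mp hj; omega
  have h := (isHomogeneous_C σ (γ j)).mul
    ((isHomogeneous_normSqForm.pow j).mul ((isHomogeneous_linearForm y).pow (k - 2 * j)))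
  convert h using 1
  omega

lemma eval_zonal (γ : ℕ → ℝ) (k : ℕ) (x y : σ → ℝ) (hx : ∑ i, x i ^ 2 = 1) :
    eval x (zonal γ k y) =
      ∑ j ∈ Finset.range (k / 2 + 1), γ j * (∑ i, x i * y i) ^ (k - 2 * j) := by
  simp [zonal, normSqForm, linearForm, hx, mul_comm]

lemma fischer_zonal (γ : ℕ → ℝ) (k : ℕ) (hγ0 : γ 0 = 1)
    (hγ : ∀ j < k / 2, γ (j + 1) * (2 * (j + 1) * (Fintype.card σ + 2 * (k - j) - 4)) =
      -((k - 2 * j) * (k - 2 * j - 1) * γ j))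
    (x y : σ → ℝ) (hx : ∑ i, x i ^ 2 = 1) (hy : ∑ i, y i ^ 2 = 1) :
    fischer (zonal γ k x) (zonal γ k y) = k.factorial *
      ∑ j ∈ Finset.range (k / 2 + 1), γ j * (∑ i, x i * y i) ^ (k - 2 * j) := by
  rw [← eval_zonal γ k x y hx, ← fischer_linearForm_pow x k _ (isHomogeneous_zonal γ k y)]
  conv_lhs => rw [zonal.eq_1 γ k x]
  rw [Finset.sum_range_succ', map_add, LinearMap.add_apply, map_sum, LinearMap.sum_apply,
    Finset.sum_eq_zero, zero_add]
  · simp [hγ0]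
  · intro j _
    rw [show C (γ (j + 1)) * (normSqForm σ ^ (j + 1) * linearForm x ^ (k - 2 * (j + 1))) =
      C (γ (j + 1)) * (normSqForm σ ^ j * linearForm x ^ (k - 2 * (j + 1))) * normSqForm σ by ring,
      fischer_mul_normSqForm, laplacian_zonal γ k hγ y hy, map_zero]

/-- Positive definiteness on the unit sphere of the kernel given by a Gegenbauer polynomial
(Schönberg), the polynomial being described by the recurrence of its coefficients. -/
theorem gegenbauer_kernel_nonneg (γ : ℕ → ℝ) (k : ℕ) (hγ0 : γ 0 = 1)
    (hγ : ∀ j < k / 2, γ (j + 1) * (2 * (j + 1) * (Fintype.card σ + 2 * (k - j) - 4)) =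
      -((k - 2 * j) * (k - 2 * j - 1) * γ j))
    {ι : Type*} [Fintype ι] (v : ι → σ → ℝ) (hv : ∀ x, ∑ i, v x i ^ 2 = 1) (w : ι → ℝ) :
    0 ≤ ∑ x, ∑ y, w x * w y *
      ∑ j ∈ Finset.range (k / 2 + 1), γ j * (∑ i, v x i * v y i) ^ (k - 2 * j) := by
  have h := fischer_self_nonneg (∑ x, w x • zonal γ k (v x))
  simp only [map_sum, LinearMap.sum_apply, map_smul, LinearMap.smul_apply, smul_eq_mul,
    fischer_zonal γ k hγ0 hγ _ _ (hv _) (hv _)] at h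
  refine nonneg_of_mul_nonneg_right (h.trans_eq ?_)
    (show (0 : ℝ) < k.factorial by exact_mod_cast k.factorial_pos)
  rw [Finset.mul_sum]
  refine Finset.sum_congr rfl fun x _ => ?_
  rw [Finset.mul_sum, Finset.mul_sum]
  refine Finset.sum_congr rfl fun y _ => ?_
  simp only [mul_comm (v y _)]
  ring

end Fischer

lemma exists_gram_of_isSymm_of_idempotent {n : ℕ} (P : Matrix (Fin n) (Fin n) ℝ)
    (hP : P.IsSymm) (hPP : P * P = P) :
    ∃ (N : ℕ) (B : Fin n → Fin N → ℝ),
      (∀ x y, ∑ k, B x k * B y k = P x y) ∧ (N : ℝ) = ∑ x, P x x := by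
  let S : Submodule ℝ (EuclideanSpace ℝ (Fin n)) := LinearMap.range (Matrix.toEuclideanLin P)
  let b := stdOrthonormalBasis ℝ S
  have hfix : ∀ k y, ∑ x, (b k : EuclideanSpace ℝ (Fin n)) x * P x y =
      (b k : EuclideanSpace ℝ (Fin n)) y := by
    intro k y
    obtain ⟨u, hu⟩ := (b k).2
    have h1 : Matrix.toEuclideanLin P (b k : EuclideanSpace ℝ (Fin n)) = b k := by
      rw [← hu]
      ext z
      simp [Matrix.toLpLin_apply, Matrix.mulVec_mulVec, hPP]
    have h2 := congrArg (fun z : EuclideanSpace ℝ (Fin n) => z y) h1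
    simp only [Matrix.toLpLin_apply, Matrix.mulVec, dotProduct] at h2
    rw [← h2]
    exact Finset.sum_congr rfl fun x _ => by rw [hP.apply, mul_comm]
  have hgram : ∀ x y, ∑ k, (b k : EuclideanSpace ℝ (Fin n)) x *
      (b k : EuclideanSpace ℝ (Fin n)) y = P x y := by
    intro x y
    let c : S := ⟨Matrix.toEuclideanLin P (EuclideanSpace.single y 1), ⟨_, rfl⟩⟩
    have hc : ∀ z, (c : EuclideanSpace ℝ (Fin n)) z = P z y := by
      intro z
      simp [c, Matrix.toLpLin_apply]
    have h := congrArg (fun z : S => (z : EuclideanSpace ℝ (Fin n)) x) (b.sum_repr' c)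
    simp only [Submodule.coe_sum, Submodule.coe_smul, Submodule.coe_inner, PiLp.inner_apply, hc,
      WithLp.ofLp_sum, Finset.sum_apply, PiLp.smul_apply, smul_eq_mul] at h
    rw [← h]
    refine Finset.sum_congr rfl fun k _ => ?_
    rw [← hfix k y, mul_comm]
    congr 1
    exact Finset.sum_congr rfl fun z _ => by simp [mul_comm]
  refine ⟨_, fun x k => (b k : EuclideanSpace ℝ (Fin n)) x, hgram, ?_⟩
  simp only [← hgram]
  rw [Finset.sum_comm]
  have hnorm : ∀ k, ∑ x, (b k : EuclideanSpace ℝ (Fin n)) x *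
      (b k : EuclideanSpace ℝ (Fin n)) x = 1 := by
    intro k
    have h := b.orthonormal.1 k
    rw [Submodule.coe_norm, EuclideanSpace.norm_eq, Real.sqrt_eq_one] at h
    simpa [sq] using h
  simp [hnorm]

/-- The entrywise Gegenbauer polynomial of the Gram matrix attached to an orthogonal projection
with constant diagonal `m / n`, paired with any orthogonal projection, is nonnegative. -/
lemma gegenbauer_moment_nonneg {n : ℕ} (hn : 0 < n) (P Q : Matrix (Fin n) (Fin n) ℝ)
    (hP : P.IsSymm) (hPP : P * P = P) (hQ : Q.IsSymm) (hQQ : Q * Q = Q)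
    (m : ℝ) (hm : 0 < m) (hdiag : ∀ x, n * P x x = m) (γ : ℕ → ℝ) (k : ℕ) (hγ0 : γ 0 = 1)
    (hγ : ∀ j < k / 2, γ (j + 1) * (2 * (j + 1) * (m + 2 * (k - j) - 4)) =
      -((k - 2 * j) * (k - 2 * j - 1) * γ j)) :
    0 ≤ ∑ j ∈ Finset.range (k / 2 + 1),
      γ j * m ^ (2 * j) * ∑ x, ∑ y, (n * P x y) ^ (k - 2 * j) * Q x y := by
  obtain ⟨N, B, hB, hN⟩ := exists_gram_of_isSymm_of_idempotent P hP hPP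
  have hn' : (0 : ℝ) < n := by exact_mod_cast hn
  have hNm : (N : ℝ) = m := by
    have h : ∀ x, P x x = m / n := fun x => by rw [← hdiag x]; field_simp
    rw [hN]
    simp only [h, Finset.sum_const, Finset.card_univ, Fintype.card_fin, nsmul_eq_mul]
    field_simp
  have hc : 0 ≤ n / m := by positivity
  let v : Fin n → Fin N → ℝ := fun x i => √(n / m) * B x i
  have hv : ∀ x y, ∑ i, v x i * v y i = n / m * P x y := by
    intro x y
    rw [← hB, Finset.mul_sum]
    refine Finset.sum_congr rfl fun i _ => ?_
    linear_combination (B x i * B y i) * Real.mul_self_sqrt hc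
  have hpos := fun z => gegenbauer_kernel_nonneg γ k hγ0 (by simpa [hNm] using hγ) v
    (fun x => by
      simp only [sq]
      rw [hv, div_mul_eq_mul_div, hdiag, div_self hm.ne']) (fun x => Q x z)
  simp only [hv] at hpos
  have hsum := mul_nonneg (pow_nonneg hm.le k) (Finset.univ.sum_nonneg fun z _ => hpos z)
  refine hsum.trans_eq ?_
  have hQsum : ∀ x y, ∑ z, Q x z * Q y z = Q x y := by
    intro x y
    conv_rhs => rw [← hQQ, Matrix.mul_apply]
    exact Finset.sum_congr rfl fun z _ => by rw [hQ.apply y z]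
  have hpow : ∀ x y, ∀ j ∈ Finset.range (k / 2 + 1),
      m ^ k * (n / m * P x y) ^ (k - 2 * j) = m ^ (2 * j) * (n * P x y) ^ (k - 2 * j) := by
    intro x y j hj
    have hj' : 2 * j ≤ k := by have := Finset.mem_range.mp hj; omega
    rw [show n / m * P x y = n * P x y / m by ring, div_pow]
    conv_lhs => rw [← Nat.add_sub_of_le hj', pow_add, Nat.add_sub_of_le hj']
    field_simp
  calc m ^ k * ∑ z, ∑ x, ∑ y, Q x z * Q y z *
        ∑ j ∈ Finset.range (k / 2 + 1), γ j * (n / m * P x y) ^ (k - 2 * j)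
      = m ^ k * ∑ x, ∑ y, Q x y *
        ∑ j ∈ Finset.range (k / 2 + 1), γ j * (n / m * P x y) ^ (k - 2 * j) := by
        rw [Finset.sum_comm]
        congr 1
        refine Finset.sum_congr rfl fun x _ => ?_
        rw [Finset.sum_comm]
        simp only [← Finset.sum_mul, hQsum]
    _ = ∑ x, ∑ y, ∑ j ∈ Finset.range (k / 2 + 1),
        γ j * m ^ (2 * j) * ((n * P x y) ^ (k - 2 * j) * Q x y) := by
        simp only [Finset.mul_sum]
        refine Finset.sum_congr rfl fun x _ => Finset.sum_congr rfl fun y _ =>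
          Finset.sum_congr rfl fun j hj => ?_
        linear_combination (Q x y * γ j) * hpow x y j hj
    _ = _ := by
        simp only [Finset.mul_sum]
        rw [Finset.sum_comm (s := Finset.range _)]
        exact Finset.sum_congr rfl fun x _ => Finset.sum_comm

/-- New realizability conditions for Q-polynomial (cometric) association schemes, obtained
from Gegenbauer polynomials of degrees 3–6 and Schönberg's theorem.  Here `E 0, …, E d`
are the primitive idempotents of the scheme (extended by `0` beyond index `d`), the reals
`q i j k` are the Krein parameters `q^k_{ij}` (extended by `0` for out-of-range indices),
the ordering is Q-polynomial, and `m = q^0_{11} > 2`.  In terms of the Krein array,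
`a*_i = q 1 i i`, `b*_i = q 1 (i+1) i`, `c*_i = q 1 (i-1) i`. -/
theorem stmt_12 (n d : ℕ) (hn : 0 < n) (hd : 3 ≤ d)
    (E : ℕ → Matrix (Fin n) (Fin n) ℝ)
    (hEsym : ∀ j, (E j).IsSymm)
    (hEtop : ∀ j, d < j → E j = 0)
    (hEorth : ∀ j k, E j * E k = if j = k then E j else 0)
    (hEsum : ∑ j ∈ Finset.range (d + 1), E j = 1)
    (hE0 : E 0 = (n : ℝ)⁻¹ • Matrix.of fun _ _ => (1 : ℝ))
    (q : ℕ → ℕ → ℕ → ℝ)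
    (hq0 : ∀ i j k, 0 ≤ q i j k)
    (hqtop : ∀ i j k, d < i ∨ d < j ∨ d < k → q i j k = 0)
    (hKrein : ∀ i j, (n : ℝ) • Matrix.hadamard (E i) (E j) =
        ∑ k ∈ Finset.range (d + 1), q i j k • E k)
    (hQP0 : ∀ j k, j ≤ d → k ≤ d → (j + 1 < k ∨ k + 1 < j) → q 1 j k = 0)
    (hQP1 : ∀ j k, j ≤ d → k ≤ d → (k = j + 1 ∨ j = k + 1) → 0 < q 1 j k)
    (m : ℝ) (hm : m = q 1 1 0) (hm2 : 2 < m) :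
    ((q 1 1 1) ^ 2 + q 1 2 1 * q 1 1 2 ≥ 2 * m * (m - 1) / (m + 2)) ∧
    ((q 1 1 1) ^ 2 + 2 * q 1 1 1 * q 1 2 2 + q 1 1 2 * q 2 2 2 ≥
        4 * m * (m - 2) / (m + 4)) ∧
    (6 * m * (m - 1) * (m - 4) / ((m + 4) * (m + 6)) +
        ((3 * q 1 1 1 * (q 1 1 1 + q 1 2 2) + q 1 1 2 * q 2 2 2) * (q 1 2 1 * q 1 1 2) +
            (q 1 1 1) ^ 4) / m ≥
      (7 * m - 18) * ((q 1 1 1) ^ 2 + q 1 2 1 * q 1 1 2) / (m + 6)) ∧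
    (q 1 2 1 * q 1 1 2 + q 1 3 2 * q 1 2 3 + q 1 4 3 * q 1 3 4 +
        q 1 1 1 * (q 1 1 1 + q 1 2 2 + q 1 3 3) + q 1 2 2 * (q 1 2 2 + q 1 3 3) +
        q 1 3 3 * q 1 3 3 ≥ 3 * (3 * m - 2) / (m + 6)) ∧
    (16 * m * (m - 1) / ((m + 4) * (m + 8)) +
        ((q 1 1 1) ^ 4 +
            (3 * q 1 1 1 * (q 1 1 1 + q 1 2 2) + q 1 1 2 * q 2 2 2) *
              (q 1 2 1 * q 1 1 2)) / ((m - 2) * m) ≥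
      12 * ((q 1 1 1) ^ 2 + q 1 2 1 * q 1 1 2) / (m + 8)) ∧
    (0 < q 1 1 1 →
      ((q 1 1 1) ^ 2 + q 1 2 1 * q 1 1 2 * (2 + q 1 2 2 / q 1 1 1) ≥
          4 * m * (2 * m - 3) / (m + 6)) ∧
      ((q 1 1 1) ^ 2 + 2 * q 1 1 1 * q 1 2 2 - (q 1 2 2) ^ 2 + 2 * q 1 1 2 * q 2 2 2 +
          (q 1 3 2 * q 1 2 3 * (q 1 3 3 - q 1 1 1) - m * q 1 2 2) /
            (q 1 1 1 + q 1 2 2) ≥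
        6 * m * (m - 4) / (m + 6))) := by
  have hn' : (0 : ℝ) < n := by exact_mod_cast hn
  have hm0 : 0 < m := by linarith
  have hE0' : ∀ x y, E 0 x y = (n : ℝ)⁻¹ := fun x y => by simp [hE0]
  have hprod : ∀ i j x y, n * (E i x y * E j x y) =
      ∑ k ∈ Finset.range (d + 1), q i j k * E k x y := by
    intro i j x y
    have h := congrFun (congrFun (hKrein i j) x) y
    simpa [Matrix.sum_apply] using h
  have hq_eq_zero : ∀ j k, j ≠ k → j ≠ k + 1 → j ≠ k + 2 → q 1 (k + 1) j = 0 := by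
    intro j k h0 h1 h2
    by_cases hj : d < j
    · exact hqtop _ _ _ (Or.inr (Or.inr hj))
    by_cases hk : d < k + 1
    · exact hqtop _ _ _ (Or.inr (Or.inl hk))
    exact hQP0 _ _ (by omega) (by omega) (by omega)
  have htri : ∀ (k : ℕ) (f : ℕ → ℝ), ∑ j ∈ Finset.range (d + 1), q 1 (k + 1) j * f j =
      q 1 (k + 1) k * f k + q 1 (k + 1) (k + 1) * f (k + 1) +
        q 1 (k + 1) (k + 2) * f (k + 2) := by
    intro k f
    have h : ∑ j ∈ ({k, k + 1, k + 2} : Finset ℕ), q 1 (k + 1) j * f j =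
        q 1 (k + 1) k * f k + q 1 (k + 1) (k + 1) * f (k + 1) +
          q 1 (k + 1) (k + 2) * f (k + 2) := by
      rw [Finset.sum_insert (by simp), Finset.sum_insert (by simp), Finset.sum_singleton, add_assoc]
    rw [← h, Finset.sum_subset (Finset.subset_union_left (s₂ := {k, k + 1, k + 2})),
      ← Finset.sum_subset Finset.subset_union_right]
    · intro j _ hj
      simp only [Finset.mem_insert, Finset.mem_singleton, not_or] at hj
      rw [hq_eq_zero j k hj.1 hj.2.1 hj.2.2, zero_mul]
    · intro j _ hj
      rw [hqtop _ _ _ (Or.inr (Or.inr (by simpa using hj))), zero_mul]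
  have hone : ∀ k x y, n * E 1 x y * E (k + 1) x y =
      q 1 (k + 1) k * E k x y + q 1 (k + 1) (k + 1) * E (k + 1) x y +
        q 1 (k + 1) (k + 2) * E (k + 2) x y := fun k x y => by
    rw [mul_assoc, hprod, htri k fun j => E j x y]
  have hrow : ∀ k x, ∑ y, E k x y = if k = 0 then 1 else 0 := by
    intro k x
    have h := congrFun (congrFun (hEorth k 0) x) x
    simp only [Matrix.mul_apply, hE0', ← Finset.sum_mul] at h
    split_ifs at h ⊢ with hk
    · subst hk
      rw [hE0'] at h
      exact mul_right_cancel₀ (inv_ne_zero hn'.ne') (by rw [h, one_mul])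
    · simpa [hn'.ne'] using h
  have hdiagmul : ∀ i j x, ∑ y, E i x y * E j x y = if i = j then E i x x else 0 := by
    intro i j x
    have h := congrFun (congrFun (hEorth i j) x) x
    rw [Matrix.mul_apply] at h
    rw [Finset.sum_congr rfl fun y _ => by rw [← (hEsym j).apply x y], h]
    split_ifs <;> rfl
  have hdiag : ∀ x, n * E 1 x x = m := by
    intro x
    have h := hdiagmul 1 1 x
    rw [if_pos rfl] at h
    rw [← h, Finset.mul_sum, Finset.sum_congr rfl fun y _ => (mul_assoc _ _ _).symm.trans
      (hone 0 x y)]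
    simp only [Finset.sum_add_distrib, ← Finset.mul_sum, hrow]
    simp [hm]
  -- Moments of `n • E 1` against the idempotents.
  obtain ⟨u, hu⟩ : ∃ u : ℕ → ℕ → ℝ, ∀ p k, u p k =
      (n : ℝ)⁻¹ * ∑ x, ∑ y, (n * E 1 x y) ^ p * E k x y := ⟨_, fun _ _ => rfl⟩
  have hu00 : u 0 0 = 1 := by
    simp [hu, hrow, hn'.ne']
  have hu0 : ∀ k, u 0 (k + 1) = 0 := by
    intro k
    simp [hu, hrow]
  have husucc0 : ∀ p, u (p + 1) 0 = u p 1 := by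
    intro p
    rw [hu, hu]
    congr 1
    refine Finset.sum_congr rfl fun x _ => Finset.sum_congr rfl fun y _ => ?_
    rw [hE0', pow_succ]
    field_simp
  have husucc : ∀ p k, u (p + 1) (k + 1) = q 1 (k + 1) k * u p k +
      q 1 (k + 1) (k + 1) * u p (k + 1) + q 1 (k + 1) (k + 2) * u p (k + 2) := by
    intro p k
    simp only [hu, pow_succ, mul_assoc ((n * E 1 _ _) ^ p), hone, mul_add, Finset.sum_add_distrib,
      mul_left_comm _ (q 1 _ _), ← Finset.mul_sum]
  have hlt : ∀ p k, p < k → u p k = 0 := by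
    intro p
    induction p with
    | zero =>
      rintro (_ | k) hk
      · omega
      · exact hu0 k
    | succ p ih =>
      rintro (_ | k) hk
      · omega
      · rw [husucc, ih k (by omega), ih (k + 1) (by omega), ih (k + 2) (by omega)]
        ring
  have hG : ∀ (γ : ℕ → ℝ) (r : ℕ), γ 0 = 1 →
      (∀ j < r / 2, γ (j + 1) * (2 * (j + 1) * (m + 2 * (r - j) - 4)) =
        -((r - 2 * j) * (r - 2 * j - 1) * γ j)) →
      ∀ k, 0 ≤ ∑ j ∈ Finset.range (r / 2 + 1), γ j * m ^ (2 * j) * u (r - 2 * j) k := by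
    intro γ r h0 h k
    have := mul_nonneg (inv_nonneg.mpr hn'.le) (gegenbauer_moment_nonneg hn (E 1) (E k) (hEsym 1)
      (by simpa using hEorth 1 1) (hEsym k) (by simpa using hEorth k k) m hm0 hdiag γ r h0 h)
    simpa only [hu, Finset.mul_sum (s := Finset.range _), mul_left_comm (n : ℝ)⁻¹] using this
  have hG3 : ∀ k, 0 ≤ u 3 k - 3 / (m + 2) * m ^ 2 * u 1 k := by
    intro k
    have h := hG (fun j => if j = 0 then 1 else -(3 / (m + 2))) 3 rfl (by
      intro j hj
      interval_cases j
      norm_num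
      field_simp
      ring) k
    norm_num [Finset.sum_range_succ] at h
    linarith
  have hG4 : ∀ k, 0 ≤ u 4 k - 6 / (m + 4) * m ^ 2 * u 2 k +
      3 / ((m + 2) * (m + 4)) * m ^ 4 * u 0 k := by
    intro k
    have h := hG (fun j => if j = 0 then 1 else if j = 1 then -(6 / (m + 4)) else
      3 / ((m + 2) * (m + 4))) 4 rfl (by
      intro j hj
      interval_cases j <;> norm_num <;> field_simp <;> ring) k
    norm_num [Finset.sum_range_succ] at h
    linarith
  have hG5 : ∀ k, 0 ≤ u 5 k - 10 / (m + 6) * m ^ 2 * u 3 k +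
      15 / ((m + 4) * (m + 6)) * m ^ 4 * u 1 k := by
    intro k
    have h := hG (fun j => if j = 0 then 1 else if j = 1 then -(10 / (m + 6)) else
      15 / ((m + 4) * (m + 6))) 5 rfl (by
      intro j hj
      interval_cases j <;> norm_num <;> field_simp <;> ring) k
    norm_num [Finset.sum_range_succ] at h
    linarith
  have hG6 : ∀ k, 0 ≤ u 6 k - 15 / (m + 8) * m ^ 2 * u 4 k +
      45 / ((m + 6) * (m + 8)) * m ^ 4 * u 2 k -
      15 / ((m + 4) * (m + 6) * (m + 8)) * m ^ 6 * u 0 k := by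
    intro k
    have h := hG (fun j => if j = 0 then 1 else if j = 1 then -(15 / (m + 8)) else
      if j = 2 then 45 / ((m + 6) * (m + 8)) else -(15 / ((m + 4) * (m + 6) * (m + 8)))) 6 rfl (by
      intro j hj
      interval_cases j <;> norm_num <;> field_simp <;> ring) k
    norm_num [Finset.sum_range_succ] at h
    linarith
  have hb1 : 0 < q 1 2 1 := hQP1 2 1 (by omega) (by omega) (by omega)
  have hb2 : 0 < q 1 3 2 := hQP1 3 2 (by omega) (by omega) (by omega)
  -- Triple intersection sums, which are symmetric in all three indices.
  obtain ⟨Y, hY⟩ : ∃ Y : ℕ → ℕ → ℕ → ℝ, ∀ i j k, Y i j k =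
      ∑ x, ∑ y, n * (E i x y * E j x y) * E k x y := ⟨_, fun _ _ _ => rfl⟩
  obtain ⟨M, hM⟩ : ∃ M : ℕ → ℝ, ∀ k, M k = ∑ x, E k x x := ⟨_, fun _ => rfl⟩
  have hYq : ∀ i j k, k ≤ d → Y i j k = q i j k * M k := by
    intro i j k hk
    rw [hY, hM, Finset.mul_sum]
    refine Finset.sum_congr rfl fun x _ => ?_
    simp only [hprod, Finset.sum_mul]
    rw [Finset.sum_comm]
    simp only [mul_assoc, ← Finset.mul_sum, hdiagmul]
    rw [Finset.sum_eq_single k]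
    · simp
    · intro l _ hl
      simp [hl]
    · intro h
      simp at h
      omega
  have hYswap : ∀ i j k, Y i j k = Y i k j := by
    intro i j k
    rw [hY, hY]
    exact Finset.sum_congr rfl fun x _ => Finset.sum_congr rfl fun y _ => by ring
  have hYcomm : ∀ i j k, Y i j k = Y j i k := by
    intro i j k
    rw [hY, hY]
    exact Finset.sum_congr rfl fun x _ => Finset.sum_congr rfl fun y _ => by ring
  have hY220 : Y 2 2 0 = M 2 := by
    rw [hY, hM]
    refine Finset.sum_congr rfl fun x _ => ?_
    have h := hdiagmul 2 2 x
    rw [if_pos rfl] at h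
    rw [← h]
    refine Finset.sum_congr rfl fun y _ => ?_
    rw [hE0']
    field_simp
  have hM1 : M 1 = m := by
    have h : ∀ x, E 1 x x = m / n := fun x => by rw [← hdiag x]; field_simp
    rw [hM]
    simp only [h, Finset.sum_const, Finset.card_univ, Fintype.card_fin, nsmul_eq_mul]
    field_simp
  have hM12 : q 1 2 1 * M 1 = q 1 1 2 * M 2 := by
    rw [← hYq 1 2 1 (by omega), ← hYq 1 1 2 (by omega), hYswap]
  have hM23 : q 1 3 2 * M 2 = q 1 2 3 * M 3 := by
    rw [← hYq 1 3 2 (by omega), ← hYq 1 2 3 hd, hYswap]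
  have hM2 : M 2 ≠ 0 := by
    intro h
    rw [h, mul_zero, hM1] at hM12
    exact (mul_pos hb1 hm0).ne' hM12
  have hK : q 1 1 2 * q 2 2 2 = q 1 2 1 * q 1 1 2 + q 1 2 2 ^ 2 + q 1 3 2 * q 1 2 3 - m -
      q 1 1 1 * q 1 2 2 := by
    have h1 : ∑ x, ∑ y, (n * E 1 x y * E 2 x y) * (n * E 1 x y * E 2 x y) =
        q 1 2 1 * Y 1 2 1 + q 1 2 2 * Y 1 2 2 + q 1 2 3 * Y 1 2 3 := by
      simp only [hY, Finset.mul_sum, ← Finset.sum_add_distrib]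
      refine Finset.sum_congr rfl fun x _ => Finset.sum_congr rfl fun y _ => ?_
      linear_combination (n * E 1 x y * E 2 x y) * hone 1 x y
    have h2 : ∑ x, ∑ y, (n * E 1 x y * E 2 x y) * (n * E 1 x y * E 2 x y) =
        m * Y 2 2 0 + q 1 1 1 * Y 2 2 1 + q 1 1 2 * Y 2 2 2 := by
      simp only [hY, Finset.mul_sum, ← Finset.sum_add_distrib]
      refine Finset.sum_congr rfl fun x _ => Finset.sum_congr rfl fun y _ => ?_
      rw [hm]
      linear_combination (n * E 2 x y * E 2 x y) * hone 0 x y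
    rw [h1, hYq 1 2 1 (by omega), hYq 1 2 2 (by omega), hYq 1 2 3 hd, hY220, hYswap 2 2 1,
      hYcomm 2 1 2, hYq 1 2 2 (by omega), hYq 2 2 2 (by omega)] at h2
    refine mul_right_cancel₀ hM2 ?_
    linear_combination -h2 + q 1 2 1 * hM12 - q 1 2 3 * hM23
  have u11 : u 1 1 = m := by
    rw [husucc 0 0, hu00, hu0, hu0, ← hm]; ring
  have u20 : u 2 0 = m := by rw [husucc0, u11]
  have u21 : u 2 1 = q 1 1 1 * m := by
    rw [husucc 1 0, husucc0 0, hu0, u11, hlt 1 2 (by omega)]; ring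
  have u22 : u 2 2 = q 1 2 1 * m := by
    rw [husucc 1 1, u11, hlt 1 2 (by omega), hlt 1 3 (by omega)]; ring
  have u31 : u 3 1 = m * (m + q 1 1 1 ^ 2 + q 1 2 1 * q 1 1 2) := by
    rw [husucc 2 0, u20, u21, u22, ← hm]; ring
  have u32 : u 3 2 = m * q 1 2 1 * (q 1 1 1 + q 1 2 2) := by
    rw [husucc 2 1, u21, u22, hlt 2 3 (by omega)]; ring
  have u33 : u 3 3 = m * q 1 2 1 * q 1 3 2 := by
    rw [husucc 2 2, u22, hlt 2 3 (by omega), hlt 2 4 (by omega)]; ring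
  have u30 : u 3 0 = m * q 1 1 1 := by rw [husucc0, u21]; ring
  have u41 : u 4 1 = m * (m * q 1 1 1 + q 1 1 1 * (m + q 1 1 1 ^ 2 + q 1 2 1 * q 1 1 2) +
      q 1 2 1 * q 1 1 2 * (q 1 1 1 + q 1 2 2)) := by
    rw [husucc 3 0, u30, u31, u32, ← hm]; ring
  have u42 : u 4 2 = m * q 1 2 1 *
      (2 * m + q 1 1 1 ^ 2 + 2 * q 1 1 1 * q 1 2 2 + q 1 1 2 * q 2 2 2) := by
    rw [husucc 3 1, u31, u32, u33, hK]; ring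
  have u43 : u 4 3 = m * q 1 2 1 * q 1 3 2 * (q 1 1 1 + q 1 2 2 + q 1 3 3) := by
    rw [husucc 3 2, u32, u33, hlt 3 4 (by omega)]; ring
  have u44 : u 4 4 = m * q 1 2 1 * q 1 3 2 * q 1 4 3 := by
    rw [husucc 3 3, u33, hlt 3 4 (by omega), hlt 3 5 (by omega)]; ring
  have u51 : u 5 1 = m * (m ^ 2 + 3 * m * (q 1 1 1 ^ 2 + q 1 2 1 * q 1 1 2) + (q 1 1 1 ^ 4 +
      (3 * q 1 1 1 * (q 1 1 1 + q 1 2 2) + q 1 1 2 * q 2 2 2) * (q 1 2 1 * q 1 1 2))) := by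
    rw [husucc 4 0, husucc0 3, u31, u41, u42, ← hm]; ring
  have u52 := husucc 4 1
  rw [u41, u42, u43] at u52
  have u53 := husucc 4 2
  rw [u42, u43, u44, hK] at u53
  have g31 := hG3 1
  have g42 := hG4 2
  have g51 := hG5 1
  have g53 := hG5 3
  have g60 := hG6 0
  have g50 := hG5 0
  have g52 := hG5 2
  rw [u31, u11] at g31
  rw [u42, u22, hu0 1] at g42
  rw [u51, u31, u11] at g51
  rw [u53, u33, hlt 1 3 (by omega)] at g53
  rw [husucc0 5, u51, husucc0 3, u31, u20, hu00] at g60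
  rw [husucc0 4, u41, u30, husucc0 0, hu0 0] at g50
  rw [u52, u32, hlt 1 2 (by omega)] at g52
  have ha1 := hq0 1 1 1
  have ha2 := hq0 1 2 2
  clear * - hm0 hm2 hb1 hb2 ha1 ha2 hK g31 g42 g51 g53 g60 g50 g52
  generalize q 1 1 1 = a₁ at *
  generalize q 1 2 2 = a₂ at *
  generalize q 1 3 3 = a₃ at *
  generalize q 1 2 1 = b₁ at *
  generalize q 1 3 2 = b₂ at *
  generalize q 1 4 3 = b₃ at *
  generalize q 1 1 2 = c₂ at *
  generalize q 1 2 3 = c₃ at *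
  generalize q 1 3 4 = c₄ at *
  generalize q 2 2 2 = r at *
  have hm2' : 0 < m - 2 := by linarith
  refine ⟨?_, ?_, ?_, ?_, ?_, fun ha => ⟨?_, ?_⟩⟩
  · rw [ge_iff_le, ← sub_nonneg]
    refine (div_nonneg g31 hm0.le).trans_eq ?_
    field_simp
    ring
  · rw [ge_iff_le, ← sub_nonneg]
    refine (div_nonneg g42 (mul_pos hm0 hb1).le).trans_eq ?_
    field_simp
    ring
  · rw [ge_iff_le, ← sub_nonneg]
    refine (div_nonneg g51 (mul_pos hm0 hm0).le).trans_eq ?_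
    field_simp
    ring
  · have h : 0 ≤ b₁ * c₂ + b₂ * c₃ + b₃ * c₄ + a₁ * (a₁ + a₂ + a₃) + a₂ * (a₂ + a₃) + a₃ * a₃ -
        m * (3 * (3 * m - 2) / (m + 6)) := by
      refine (div_nonneg g53 (mul_pos (mul_pos hm0 hb1) hb2).le).trans_eq ?_
      field_simp
      ring
    have h' : 0 ≤ 3 * (3 * m - 2) / (m + 6) := div_nonneg (by linarith) (by linarith)
    nlinarith
  · rw [ge_iff_le, ← sub_nonneg]
    refine (div_nonneg g60 (mul_pos (mul_pos hm0 hm0) hm2').le).trans_eq ?_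
    field_simp
    ring
  · rw [ge_iff_le, ← sub_nonneg]
    refine (div_nonneg g50 (mul_pos hm0 ha).le).trans_eq ?_
    field_simp
    ring
  · have hA : 0 < a₁ + a₂ := by linarith
    have hB : b₁ * c₂ = c₂ * r - a₂ ^ 2 - b₂ * c₃ + m + a₁ * a₂ := by linear_combination -hK
    have hC : 0 ≤ 2 * m * a₁ + a₁ * (a₁ ^ 2 + b₁ * c₂) + b₁ * c₂ * (a₁ + a₂) +
        a₂ * (2 * m + a₁ ^ 2 + 2 * a₁ * a₂ + c₂ * r) + b₂ * c₃ * (a₁ + a₂ + a₃) -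
        10 / (m + 6) * m ^ 2 * (a₁ + a₂) := by
      refine (div_nonneg g52 (mul_pos hm0 hb1).le).trans_eq ?_
      field_simp
      ring
    rw [hB] at hC
    rw [ge_iff_le, ← sub_nonneg]
    refine (div_nonneg hC hA.le).trans_eq ?_
    field_simp
    ring
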